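/- For every discount factor λ ∈ [0,1), every initial state s₀ ∈ S, every player i ∈ I, every partition 𝒟^i of the set of states, every cutoff vector c^i ∈ ℝ^{𝒟^i}, and every stationary strategy profile x^{-i} of the players other than i, there is a stationary strategy x^i of player i that maximizes player i's modified payoff among all strategies: γ̂^i_λ(s₀,x^i,x^{-i};𝒟^i,c^i) = max_{σ^i∈Σ^i} γ̂^i_λ(s₀,σ^i,x^{-i};𝒟^i,c^i). -/

import Mathlib

open MeasureTheory Filter Topology
open scoped ENNReal

noncomputable section

/-- A finite stochastic game: a finite set of players `I`, a finite set of states `S`,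
finite nonempty action sets `A i s`, stage payoffs `u` bounded by `1` in absolute value,
and transition probabilities `q`. -/
structure StocGame where
  (I : Type)
  (S : Type)
  (A : I → S → Type)
  [fintypeI : Fintype I]
  [fintypeS : Fintype S]
  [decI : DecidableEq I]
  [decS : DecidableEq S]
  [fintypeA : ∀ i s, Fintype (A i s)]
  [decA : ∀ i s, DecidableEq (A i s)]
  [nonemptyA : ∀ i s, Nonempty (A i s)]
  (u : I → (s : S) → ((j : I) → A j s) → ℝ)
  (u_bdd : ∀ i s a, |u i s a| ≤ 1)
  (q : (s : S) → ((j : I) → A j s) → S → ℝ)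
  (q_nonneg : ∀ s a s', 0 ≤ q s a s')
  (q_sum : ∀ s a, ∑ s', q s a s' = 1)

namespace StocGame

attribute [instance] fintypeI fintypeS decI decS fintypeA decA nonemptyA

/-- A mixed action over a finite set of actions. -/
abbrev Mixed (α : Type) [Fintype α] : Type := {f : α → ℝ // (∀ a, 0 ≤ f a) ∧ ∑ a, f a = 1}

variable {G : StocGame}

/-- Action profiles available at state `s`. -/
abbrev Prof (G : StocGame) (s : G.S) : Type := (j : G.I) → G.A j s

/-- A pair of a state together with an action profile at that state. -/
abbrev Step (G : StocGame) : Type := Σ s : G.S, G.Prof s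

/-- A finite history: a (reversed) list of past (state, action profile) steps,
together with the current state. -/
abbrev Hist (G : StocGame) : Type := List G.Step × G.S

/-- A behavior strategy of player `i`. -/
abbrev BStrat (G : StocGame) (i : G.I) : Type := (h : G.Hist) → Mixed (G.A i h.2)

/-- A (behavior) strategy profile. -/
abbrev Profile (G : StocGame) : Type := (i : G.I) → G.BStrat i

/-- A stationary strategy of player `i`. -/
abbrev Stat (G : StocGame) (i : G.I) : Type := (s : G.S) → Mixed (G.A i s)

/-- A stationary strategy profile. -/
abbrev StatProf (G : StocGame) : Type := (i : G.I) → G.Stat i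

/-- The behavior strategy profile induced by a stationary strategy profile. -/
def toB (x : G.StatProf) : G.Profile := fun i h => x i h.2

/-- The behavior strategy induced by a stationary strategy. -/
def toB1 {i : G.I} (x : G.Stat i) : G.BStrat i := fun h => x h.2

/-- A stationary strategy profile is pure if at every state each player
puts probability `1` on a single action. -/
def IsPureStat (x : G.StatProf) : Prop :=
  ∀ (i : G.I) (s : G.S), ∃ a : G.A i s, ∀ b, (x i s).1 b = if b = a then 1 else 0

/-- The probability, under strategy profile `σ` and initial state `s0`, that the play follows
the finite history whose (reversed) list of steps is the first argument and whose current
state is the second argument. -/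
def probHistAux (s0 : G.S) (σ : G.Profile) : List G.Step → G.S → ℝ
  | [], s => if s = s0 then 1 else 0
  | ⟨s', a⟩ :: rest, s =>
      probHistAux s0 σ rest s' * (∏ i, (σ i (rest, s')).1 (a i)) * G.q s' a s

/-- The probability that the play follows the finite history `h`. -/
def probHist (s0 : G.S) (σ : G.Profile) (h : G.Hist) : ℝ := probHistAux s0 σ h.1 h.2

/-- The expected `lam`-discounted time `t_lam(s0,σ;s,a)` that the play spends at the
state-action pair `st = (s,a)`. -/
def tStep (lam : ℝ) (s0 : G.S) (σ : G.Profile) (st : G.Step) : ℝ :=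
  (1 - lam) *
    ∑' h : G.Hist, (if h.1.head? = some st then lam ^ (h.1.length - 1) * probHist s0 σ h else 0)

/-- The expected `lam`-discounted time that the play spends in the set of states `D`. -/
def tSet (lam : ℝ) (s0 : G.S) (σ : G.Profile) (D : Finset G.S) : ℝ :=
  ∑ st : G.Step, if st.1 ∈ D then tStep lam s0 σ st else 0

/-- The `lam`-discounted (unnormalized) payoff `U^i_lam(s0,σ;D)` that player `i` receives
while the play is in `D`. -/
def UD (lam : ℝ) (s0 : G.S) (σ : G.Profile) (i : G.I) (D : Finset G.S) : ℝ :=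
  ∑ st : G.Step, if st.1 ∈ D then tStep lam s0 σ st * G.u i st.1 st.2 else 0

/-- The `lam`-discounted payoff of player `i`. -/
def payoffD (lam : ℝ) (s0 : G.S) (σ : G.Profile) (i : G.I) : ℝ :=
  ∑ st : G.Step, tStep lam s0 σ st * G.u i st.1 st.2

/-- `Di` is a partition of the set of states. -/
def IsPartitionF (Di : Finset (Finset G.S)) : Prop :=
  ∀ s : G.S, ∃! D : Finset G.S, D ∈ Di ∧ s ∈ D

/-- The payoff of player `i` in the modified game, given the partition `Di` and
the cutoffs `c`. -/
def modPayoff (lam : ℝ) (s0 : G.S) (σ : G.Profile) (i : G.I)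
    (Di : Finset (Finset G.S)) (c : Finset G.S → ℝ) : ℝ :=
  ∑ D ∈ Di, min (UD lam s0 σ i D) (tSet lam s0 σ D * c D)

/-- The `lam`-discounted min-max value of player `i` in the original game. -/
def minmaxOrig (G : StocGame) (lam : ℝ) (s0 : G.S) (i : G.I) : ℝ :=
  ⨅ σ : G.Profile, ⨆ σi : G.BStrat i, payoffD lam s0 (Function.update σ i σi) i

/-- The `lam`-discounted max-min value of player `i` in the original game. -/
def maxminOrig (G : StocGame) (lam : ℝ) (s0 : G.S) (i : G.I) : ℝ :=
  ⨆ σi : G.BStrat i, ⨅ σ : G.Profile, payoffD lam s0 (Function.update σ i σi) i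

/-- The min-max value of player `i` in the modified game. -/
def minmaxMod (G : StocGame) (lam : ℝ) (s0 : G.S) (i : G.I)
    (Di : Finset (Finset G.S)) (c : Finset G.S → ℝ) : ℝ :=
  ⨅ σ : G.Profile, ⨆ σi : G.BStrat i,
    modPayoff lam s0 (Function.update σ i σi) i Di c

/-- The max-min value of player `i` in the modified game. -/
def maxminMod (G : StocGame) (lam : ℝ) (s0 : G.S) (i : G.I)
    (Di : Finset (Finset G.S)) (c : Finset G.S → ℝ) : ℝ :=
  ⨆ σi : G.BStrat i, ⨅ σ : G.Profile,
    modPayoff lam s0 (Function.update σ i σi) i Di c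

/-- The min-max value in stationary strategies of player `i` in the modified game. -/
def minmaxModStat (G : StocGame) (lam : ℝ) (s0 : G.S) (i : G.I)
    (Di : Finset (Finset G.S)) (c : Finset G.S → ℝ) : ℝ :=
  ⨅ x : G.StatProf, ⨆ xi : G.Stat i,
    modPayoff lam s0 (Function.update (toB x) i (toB1 xi)) i Di c

/-- The max-min value in stationary strategies of player `i` in the modified game. -/
def maxminModStat (G : StocGame) (lam : ℝ) (s0 : G.S) (i : G.I)
    (Di : Finset (Finset G.S)) (c : Finset G.S → ℝ) : ℝ :=
  ⨆ xi : G.Stat i, ⨅ x : G.StatProf,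
    modPayoff lam s0 (Function.update (toB x) i (toB1 xi)) i Di c

/-! ### Plays and the induced measure -/

/-- A play: the infinite sequence of (state, action profile) pairs. -/
abbrev Play (G : StocGame) : Type := ℕ → G.Step

instance : MeasurableSpace G.Step := ⊤

/-- The finite history consisting of the first `n` stages of the play `p`
(reversed list of the first `n` steps, together with the state at stage `n`). -/
def histOf (p : G.Play) : ℕ → G.Hist
  | 0 => ([], (p 0).1)
  | n + 1 => ((p n) :: (histOf p n).1, (p (n + 1)).1)

/-- The cylinder set of plays whose initial segment is the finite history `h`. -/
def cylSet (h : G.Hist) : Set G.Play := {p | histOf p h.1.length = h}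

/-- `μfam` is the family of probability measures on plays induced (via the
Ionescu–Tulcea theorem) by the initial state and the strategy profile:
it is characterized by being a probability measure giving each cylinder set
the probability of the corresponding finite history. -/
def IsInduced (μfam : G.S → G.Profile → Measure G.Play) : Prop :=
  (∀ s0 σ, IsProbabilityMeasure (μfam s0 σ)) ∧
  ∀ (s0 : G.S) (σ : G.Profile) (h : G.Hist),
    μfam s0 σ (cylSet h) = ENNReal.ofReal (probHist s0 σ h)

/-- A bounded stopping time (with respect to the filtration generated by finite histories). -/
def IsBddST (τ : G.Play → ℕ) : Prop :=
  (∃ B, ∀ p, τ p ≤ B) ∧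
  ∀ p p' n, τ p = n → histOf p n = histOf p' n → τ p' = n

/-- Two states lie in the same element of the partition `Di`. -/
def sameOf (Di : Finset (Finset G.S)) (s s' : G.S) : Prop := ∃ D ∈ Di, s ∈ D ∧ s' ∈ D

open Classical in
/-- The number of switches between elements of a partition along a play,
where the partition is described through the relation `r` ("being in the same element"). -/
def Zsw (r : G.S → G.S → Prop) (p : G.Play) : ℝ≥0∞ :=
  ∑' n : ℕ, if r (p n).1 (p (n + 1)).1 then 0 else 1

/-- The stopping times `τ^𝒟_k` indicating when the play moves from one element of
the partition (described by the relation `r`) to another. -/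
def switchT (r : G.S → G.S → Prop) (p : G.Play) : ℕ → ℕ∞
  | 0 => 0
  | k + 1 => sInf {n : ℕ∞ | ∃ m : ℕ, n = (m : ℕ∞) ∧ switchT r p k < (m : ℕ∞) ∧
      ¬ r (p (m - 1)).1 (p m).1}

/-- The expected average payoff of player `i` in the `N`-stage game. -/
def payoffN (μfam : G.S → G.Profile → Measure G.Play) (N : ℕ) (s0 : G.S)
    (σ : G.Profile) (i : G.I) : ℝ :=
  (∫ p, (∑ n ∈ Finset.range N, G.u i (p n).1 (p n).2) ∂(μfam s0 σ)) / N

/-- `σi` is a uniform `ε`-max-min strategy of player `i` (with respect to the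
uniform max-min value function `v`). -/
def UnifMaxMin (μfam : G.S → G.Profile → Measure G.Play) (v : G.S → ℝ) (i : G.I)
    (σi : G.BStrat i) (ε : ℝ) : Prop :=
  ∃ lam0 : ℝ, 0 ≤ lam0 ∧ lam0 < 1 ∧ ∃ N0 : ℕ,
    ∀ (s0 : G.S) (σ : G.Profile),
      (∀ lam : ℝ, lam0 < lam → lam < 1 →
        v s0 - ε ≤ payoffD lam s0 (Function.update σ i σi) i) ∧
      (∀ τ : G.Play → ℕ, IsBddST τ →
        (N0 : ℝ) ≤ ∫ p, (τ p : ℝ) ∂(μfam s0 (Function.update σ i σi)) →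
        (v s0 - ε) * ∫ p, (τ p : ℝ) ∂(μfam s0 (Function.update σ i σi)) ≤
          ∫ p, (∑ n ∈ Finset.range (τ p), G.u i (p n).1 (p n).2)
            ∂(μfam s0 (Function.update σ i σi)))

/-- `σi` is `(𝒟,ε)`-max-min preserving, where the partition `𝒟` is described by the
relation `r`, and the conditional-expectation requirement is expressed through
integrals over the atoms (cylinder sets) of the σ-algebra of the stopping time `τ^𝒟_k`. -/
def PreservingPart (μfam : G.S → G.Profile → Measure G.Play) (v : G.S → ℝ)
    (r : G.S → G.S → Prop) (i : G.I) (σi : G.BStrat i) (ε : ℝ) : Prop :=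
  ∀ (s0 : G.S) (σ : G.Profile) (k : ℕ) (τ' : G.Play → ℕ), IsBddST τ' →
    (∀ p, switchT r p k ≠ ⊤ →
      switchT r p k < (τ' p : ℕ∞) ∧ (τ' p : ℕ∞) ≤ switchT r p (k + 1)) →
    ∀ h : G.Hist, (∀ p ∈ cylSet h, switchT r p k = (h.1.length : ℕ∞)) →
      ∫ p in cylSet h, (v h.2 - ε) ∂(μfam s0 (Function.update σ i σi)) ≤
        ∫ p in cylSet h, v ((p (τ' p)).1) ∂(μfam s0 (Function.update σ i σi))

/-- `σi` is `ε`-max-min preserving (with respect to arbitrary bounded stopping times);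
again the conditional-expectation requirement is expressed through integrals over the
atoms of the σ-algebra of the stopping time `τ`. -/
def PreservingST (μfam : G.S → G.Profile → Measure G.Play) (v : G.S → ℝ) (i : G.I)
    (σi : G.BStrat i) (ε : ℝ) : Prop :=
  ∀ (s0 : G.S) (σ : G.Profile) (τ τ' : G.Play → ℕ), IsBddST τ → IsBddST τ' →
    (∀ p, τ p < τ' p) →
    ∀ h : G.Hist, (∀ p ∈ cylSet h, τ p = h.1.length) →
      ∫ p in cylSet h, (v h.2 - ε) ∂(μfam s0 (Function.update σ i σi)) ≤
        ∫ p in cylSet h, v ((p (τ' p)).1) ∂(μfam s0 (Function.update σ i σi))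

/-- A history enters a new element of the partition (described by `r`) at its final stage. -/
def entersNew (r : G.S → G.S → Prop) (h : G.Hist) : Prop :=
  match h.1 with
  | [] => True
  | st :: _ => ¬ r st.1 h.2

/-- `σi` is `𝒟`-Markovian: its continuation strategy coincides after any two finite histories
that end at the same state and whose final stage enters a new element of the partition
(described by `r`). -/
def Markovian (r : G.S → G.S → Prop) {i : G.I} (σi : G.BStrat i) : Prop :=
  ∀ h h' : G.Hist, h.2 = h'.2 → entersNew r h → entersNew r h' →
    ∀ (l : List G.Step) (s'' : G.S), σi (l ++ h.1, s'') = σi (l ++ h'.1, s'')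

open Classical in
/-- The portion of the history since the last time the play entered a new element of the
partition (described by `r`): (reversed) list of steps, given the current state. -/
def philist (r : G.S → G.S → Prop) : List G.Step → G.S → List G.Step
  | [], _ => []
  | st :: rest, s => if r st.1 s then st :: philist r rest st.1 else []

/-- The restart strategy `σ^i_𝒟`: whenever the play enters a new element of the partition
(described by `r`), player `i` forgets past play and restarts playing `σi`. -/
def restart {i : G.I} (σi : G.BStrat i) (r : G.S → G.S → Prop) : G.BStrat i :=
  fun h => σi (philist r h.1 h.2, h.2)

/-- The partition `Di` satisfies Property P with respect to player `i`
(whose uniform max-min value function is `v`). -/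
def PropertyP (μfam : G.S → G.Profile → Measure G.Play) (v : G.S → ℝ) (i : G.I)
    (Di : Finset (Finset G.S)) : Prop :=
  ∃ ζ : ℝ, 0 < ζ ∧ ∀ ε : ℝ, 0 < ε → ∃ σi : G.BStrat i,
    Markovian (sameOf Di) σi ∧ UnifMaxMin μfam v i σi ε ∧
    ∀ (s0 : G.S) (σ : G.Profile), ∃ E : Set G.Play,
      ENNReal.ofReal (1 - ε) < μfam s0 (Function.update σ i σi) E ∧
      ∫⁻ p in E, Zsw (sameOf Di) p ∂(μfam s0 (Function.update σ i σi)) ≤ ENNReal.ofReal ζ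

/-- The strategy profile `σ` (whose `i`-th coordinate is the strategy of player `i`) makes
player `i`'s strategy a uniform `𝒟`-subgame-perfect `ε`-min-max strategy against the others'
strategies, at the initial state `s0`; `vbar` is the uniform min-max value function of
player `i`, and the partition `𝒟` is described by the relation `r`.  Conditional-expectation
requirements are expressed through integrals over the atoms (cylinder sets) of the σ-algebra
of the stopping time `τ^𝒟_k`. -/
def SubgamePerfect (μfam : G.S → G.Profile → Measure G.Play) (vbar : G.S → ℝ)
    (r : G.S → G.S → Prop) (i : G.I) (σ : G.Profile) (s0 : G.S) (ε : ℝ) : Prop :=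
  ∃ N0 : ℕ, 0 < N0 ∧
    (∀ N : ℕ, N0 ≤ N → vbar s0 - ε ≤ payoffN μfam N s0 σ i) ∧
    (∀ (k : ℕ) (τ : G.Play → ℕ), IsBddST τ → (∀ p, switchT r p k ≤ (τ p : ℕ∞)) →
      ∀ h : G.Hist, (∀ p ∈ cylSet h, switchT r p k = (h.1.length : ℕ∞)) →
        (∫ p in cylSet h, (vbar h.2 - ε) ∂(μfam s0 σ) ≤
          ∫ p in cylSet h, vbar ((p (τ p)).1) ∂(μfam s0 σ)) ∧
        ((N0 : ℝ) * (μfam s0 σ (cylSet h)).toReal ≤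
            ∫ p in cylSet h, ((τ p : ℝ) - (h.1.length : ℝ)) ∂(μfam s0 σ) →
          (vbar h.2 - ε) * ∫ p in cylSet h, ((τ p : ℝ) - (h.1.length : ℝ)) ∂(μfam s0 σ) ≤
            ∫ p in cylSet h, (∑ n ∈ Finset.Ico h.1.length (τ p), G.u i (p n).1 (p n).2)
              ∂(μfam s0 σ)))

/-- The partition `Di` satisfies Property P' with respect to player `i`
(whose uniform min-max value function is `vbar`). -/
def PropertyP' (μfam : G.S → G.Profile → Measure G.Play) (vbar : G.S → ℝ) (i : G.I)
    (Di : Finset (Finset G.S)) : Prop :=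
  ∃ ζ : ℝ, 0 < ζ ∧ ∀ ε : ℝ, 0 < ε → ∀ (s0 : G.S) (σ : G.Profile), ∃ σi : G.BStrat i,
    SubgamePerfect μfam vbar (sameOf Di) i (Function.update σ i σi) s0 ε ∧
    ∃ E : Set G.Play,
      ENNReal.ofReal (1 - ε) ≤ μfam s0 (Function.update σ i σi) E ∧
      ∫⁻ p in E, Zsw (sameOf Di) p ∂(μfam s0 (Function.update σ i σi)) ≤ ENNReal.ofReal ζ

/-! ### Reachability, closed and strongly controllable sets -/

/-- The first arrival time to the set of states `C`. -/
def hitT (C : Set G.S) (p : G.Play) : ℕ∞ :=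
  sInf {n : ℕ∞ | ∃ m : ℕ, n = (m : ℕ∞) ∧ (p m).1 ∈ C}

/-- State `s` leads in `D` to state `s'`. -/
def LeadsIn (μfam : G.S → G.Profile → Measure G.Play) (D : Set G.S) (s s' : G.S) : Prop :=
  ∃ σ : G.Profile, μfam s σ {p | hitT {s'} p < hitT Dᶜ p} = 1

/-- The states `s` and `s'` are `D`-siblings. -/
def Siblings (μfam : G.S → G.Profile → Measure G.Play) (D : Set G.S) (s s' : G.S) : Prop :=
  LeadsIn μfam D s s' ∧ LeadsIn μfam D s' s

/-- The probability `q(D | s, a)` that the next state lies in `D`. -/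
def qOf (D : Set G.S) (s : G.S) (a : G.Prof s) : ℝ := ∑ s', D.indicator (G.q s a) s'

/-- The set of states `D` is closed. -/
def ClosedSet (G : StocGame) (D : Set G.S) : Prop :=
  ∀ s ∈ D, ∀ a : G.Prof s, qOf D s a = 1

/-- The set of states `D` is strongly controllable. -/
def StronglyContr (G : StocGame) (D : Set G.S) : Prop :=
  ∃ iD : G.I, ∃ sD ∈ D, ∃ atil : G.A iD sD,
    ∀ s ∈ D, ∀ a : G.Prof s, qOf D s a < 1 → s = sD ∧ HEq (a iD) atil

/-- The element of the partition `𝒟` (by the vector of uniform min-max values `v`)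
that contains the state `s`. -/
def Dv (v : G.I → G.S → ℝ) (s : G.S) : Set G.S := {s' | ∀ i, v i s' = v i s}

/-- The element of the refined partition `𝒟*` (refining `𝒟` by the `D`-siblings relation)
that contains the state `s`. -/
def DstarCl (μfam : G.S → G.Profile → Measure G.Play) (v : G.I → G.S → ℝ) (s : G.S) :
    Set G.S := {s' | s' ∈ Dv v s ∧ Siblings μfam (Dv v s) s s'}

/-- The stochastic game is strongly controllable: every element of `𝒟*` is either closed
or strongly controllable. -/
def StronglyControllableGame (G : StocGame) (μfam : G.S → G.Profile → Measure G.Play)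
    (v : G.I → G.S → ℝ) : Prop :=
  ∀ s : G.S, ClosedSet G (DstarCl μfam v s) ∨ StronglyContr G (DstarCl μfam v s)

end StocGame

/-- A set `X ⊆ ℝ^ι` is monovex if every two points of `X` are connected by a continuous
path inside `X` all of whose coordinates are monotone. -/
def Monovex {ι : Type} (X : Set (ι → ℝ)) : Prop :=
  ∀ x ∈ X, ∀ y ∈ X, ∃ f : ℝ → ι → ℝ,
    ContinuousOn f (Set.Icc 0 1) ∧ (∀ t ∈ Set.Icc (0 : ℝ) 1, f t ∈ X) ∧
    f 0 = x ∧ f 1 = y ∧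
    ∀ j : ι, MonotoneOn (fun t => f t j) (Set.Icc 0 1) ∨
      AntitoneOn (fun t => f t j) (Set.Icc 0 1)

end

/-- Summing a nonnegative function over lists by splitting off the head. -/
theorem hasSum_list_of_cons {α : Type*} [Fintype α] {f : List α → ℝ} (hf : ∀ l, 0 ≤ f l) {b : ℝ}
    (h : HasSum (fun l => ∑ a, f (a :: l)) b) : HasSum f (f [] + b) := by
  let e : Unit ⊕ List α × α ≃ List α :=
    { toFun := Sum.elim (fun _ => []) fun p => p.2 :: p.1
      invFun := fun l => match l with
        | [] => Sum.inl ()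
        | a :: l => Sum.inr (l, a)
      left_inv := by rintro (_ | ⟨l, a⟩) <;> rfl
      right_inv := by rintro (_ | ⟨a, l⟩) <;> rfl }
  have hs : Summable fun p : List α × α => f (p.2 :: p.1) := by
    refine (summable_prod_of_nonneg fun p => hf _).2 ⟨fun l => (hasSum_fintype _).summable, ?_⟩
    simpa only [tsum_fintype] using h.summable
  have hp : HasSum (fun p : List α × α => f (p.2 :: p.1)) b := by
    have h2 := hs.hasSum.prod_fiberwise (fun l => hasSum_fintype _)
    exact h.unique h2 ▸ hs.hasSum
  exact e.hasSum_iff.1 ((hasSum_unique (f ∘ e ∘ Sum.inl)).sum hp)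

namespace StocGame

variable {G : StocGame}

/-- The weight given to an action profile by the players other than `i`. -/
def othersWeight (x : G.StatProf) (i : G.I) (st : G.Step) : ℝ :=
  ∏ j ∈ Finset.univ.erase i, (x j st.1).1 (st.2 j)

/-- The expected discounted number of times that player `i` plays a given action at a
given state. -/
noncomputable def occupation (lam : ℝ) (s0 : G.S) (σ : G.Profile) (i : G.I) (z : Σ s, G.A i s) : ℝ :=
  ∑' l : List G.Step, lam ^ l.length * probHistAux s0 σ l z.1 * (σ i (l, z.1)).1 z.2

/-- The flow polytope of the Markov decision problem faced by player `i`. -/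
def IsFlow (lam : ℝ) (s0 : G.S) (x : G.StatProf) (i : G.I) (m : (Σ s, G.A i s) → ℝ) : Prop :=
  (∀ z, 0 ≤ m z) ∧ ∀ s, ∑ a, m ⟨s, a⟩ = (if s = s0 then 1 else 0) +
    lam * ∑ st : G.Step, m ⟨st.1, st.2 i⟩ * othersWeight x i st * G.q st.1 st.2 s

/-- The modified payoff as a function of the occupation measure of player `i`. -/
def flowPayoff (lam : ℝ) (x : G.StatProf) (i : G.I) (Di : Finset (Finset G.S))
    (c : Finset G.S → ℝ) (m : (Σ s, G.A i s) → ℝ) : ℝ :=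
  ∑ D ∈ Di, min
    (∑ st : G.Step, if st.1 ∈ D then
      (1 - lam) * (m ⟨st.1, st.2 i⟩ * othersWeight x i st) * G.u i st.1 st.2 else 0)
    ((∑ st : G.Step, if st.1 ∈ D then
      (1 - lam) * (m ⟨st.1, st.2 i⟩ * othersWeight x i st) else 0) * c D)

theorem sum_prod_mixed {s : G.S} (y : (j : G.I) → Mixed (G.A j s)) :
    ∑ a : G.Prof s, ∏ j, (y j).1 (a j) = 1 := by
  rw [← Fintype.prod_sum]
  exact Finset.prod_eq_one fun j _ => (y j).2.2

theorem probHistAux_nonneg (s0 : G.S) (σ : G.Profile) (l : List G.Step) (s : G.S) :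
    0 ≤ probHistAux s0 σ l s := by
  induction l generalizing s with
  | nil => simp only [probHistAux]; split_ifs <;> norm_num
  | cons st l ih =>
    exact mul_nonneg (mul_nonneg (ih _) (Finset.prod_nonneg fun j _ => (σ j _).2.1 _))
      (G.q_nonneg _ _ _)

theorem sum_probHistAux_cons (s0 : G.S) (σ : G.Profile) (l : List G.Step) :
    ∑ st : G.Step, ∑ s, probHistAux s0 σ (st :: l) s = ∑ s, probHistAux s0 σ l s := by
  simp only [probHistAux, ← Finset.mul_sum, G.q_sum, mul_one]
  rw [Fintype.sum_sigma]
  simp only [← Finset.mul_sum, sum_prod_mixed, mul_one]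

theorem sum_probHistAux_ofFn (s0 : G.S) (σ : G.Profile) (n : ℕ) :
    ∑ f : Fin n → G.Step, ∑ s, probHistAux s0 σ (List.ofFn f) s = 1 := by
  induction n with
  | zero => simp [probHistAux]
  | succ n ih =>
    rw [← (Fin.consEquiv fun _ => G.Step).sum_comp, Fintype.sum_prod_type_right]
    simp only [Fin.consEquiv, Equiv.coe_fn_mk, List.ofFn_cons, sum_probHistAux_cons]
    exact ih

theorem summable_probHistAux {lam : ℝ} (h0 : 0 ≤ lam) (h1 : lam < 1) (s0 : G.S)
    (σ : G.Profile) (s : G.S) :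
    Summable fun l : List G.Step => lam ^ l.length * probHistAux s0 σ l s := by
  have h : Summable fun l : List G.Step => lam ^ l.length * ∑ s, probHistAux s0 σ l s := by
    rw [← List.equivSigmaTuple.symm.summable_iff]
    refine (summable_sigma_of_nonneg fun p => ?_).2
      ⟨fun n => (hasSum_fintype _).summable, ?_⟩
    · exact mul_nonneg (pow_nonneg h0 _) (Finset.sum_nonneg fun _ _ => probHistAux_nonneg ..)
    · simp only [tsum_fintype, Function.comp_apply, List.equivSigmaTuple, Equiv.coe_fn_symm_mk,
        List.length_ofFn, ← Finset.mul_sum, sum_probHistAux_ofFn, mul_one]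
      exact summable_geometric_of_lt_one h0 h1
  refine h.of_nonneg_of_le (fun l => mul_nonneg (pow_nonneg h0 _) (probHistAux_nonneg ..))
    fun l => mul_le_mul_of_nonneg_left ?_ (pow_nonneg h0 _)
  exact Finset.single_le_sum (f := fun s => probHistAux s0 σ l s)
    (fun _ _ => probHistAux_nonneg ..) (Finset.mem_univ s)

theorem hasSum_occupation {lam : ℝ} (h0 : 0 ≤ lam) (h1 : lam < 1) (s0 : G.S)
    (σ : G.Profile) (i : G.I) (z : Σ s, G.A i s) :
    HasSum (fun l : List G.Step => lam ^ l.length * probHistAux s0 σ l z.1 *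
      (σ i (l, z.1)).1 z.2) (occupation lam s0 σ i z) := by
  refine Summable.hasSum ?_
  have hn (l : List G.Step) : 0 ≤ lam ^ l.length * probHistAux s0 σ l z.1 :=
    mul_nonneg (pow_nonneg h0 _) (probHistAux_nonneg ..)
  refine (summable_probHistAux h0 h1 s0 σ z.1).of_nonneg_of_le
    (fun l => mul_nonneg (hn l) ((σ i _).2.1 _)) fun l => mul_le_of_le_one_right (hn l) ?_
  exact (Finset.single_le_sum (fun a _ => (σ i (l, z.1)).2.1 a) (Finset.mem_univ z.2)).trans_eq
    (σ i (l, z.1)).2.2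

theorem prod_update_toB (x : G.StatProf) (i : G.I) (σi : G.BStrat i) (l : List G.Step)
    (st : G.Step) :
    ∏ j, (Function.update (toB x) i σi j (l, st.1)).1 (st.2 j) =
      (Function.update (toB x) i σi i (l, st.1)).1 (st.2 i) * othersWeight x i st := by
  rw [← Finset.mul_prod_erase _ _ (Finset.mem_univ i), othersWeight]
  congr 1
  refine Finset.prod_congr rfl fun j hj => ?_
  rw [Function.update_of_ne (Finset.ne_of_mem_erase hj), toB]

theorem tStep_eq_occupation {lam : ℝ} (h0 : 0 ≤ lam) (h1 : lam < 1) (s0 : G.S)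
    (x : G.StatProf) (i : G.I) (σi : G.BStrat i) (st : G.Step) :
    tStep lam s0 (Function.update (toB x) i σi) st = (1 - lam) *
      (occupation lam s0 (Function.update (toB x) i σi) i ⟨st.1, st.2 i⟩ *
        othersWeight x i st) := by
  set σ := Function.update (toB x) i σi with hσ
  rw [tStep]
  congr 1
  let f : G.Hist → ℝ := fun h =>
    if h.1.head? = some st then lam ^ (h.1.length - 1) * probHist s0 σ h else 0
  have hf (h) : 0 ≤ f h := by
    dsimp only [f]
    split_ifs
    · exact mul_nonneg (pow_nonneg h0 _) (probHistAux_nonneg ..)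
    · rfl
  have hl : HasSum (fun l => ∑ s, f (l, s))
      (occupation lam s0 σ i ⟨st.1, st.2 i⟩ * othersWeight x i st) := by
    have := hasSum_list_of_cons (f := fun l => ∑ s, f (l, s))
      (b := occupation lam s0 σ i ⟨st.1, st.2 i⟩ * othersWeight x i st)
      (fun l => Finset.sum_nonneg fun s _ => hf _) ?_
    · simpa [f] using this
    · refine HasSum.congr_fun
        ((hasSum_occupation h0 h1 s0 σ i ⟨st.1, st.2 i⟩).mul_right (othersWeight x i st))
        fun l => ?_
      rw [Finset.sum_eq_single st]
      · simp only [f, probHist, probHistAux, List.head?_cons, if_true, List.length_cons,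
          Nat.add_sub_cancel, ← Finset.mul_sum, G.q_sum, mul_one]
        rw [hσ, prod_update_toB]
        ring
      · intro b _ hb
        simp [f, hb]
      · simp
  have hs : Summable f := (summable_prod_of_nonneg hf).2
    ⟨fun l => (hasSum_fintype _).summable, by simpa only [tsum_fintype] using hl.summable⟩
  exact (hs.hasSum.prod_fiberwise fun l => hasSum_fintype _).unique hl

theorem isFlow_occupation {lam : ℝ} (h0 : 0 ≤ lam) (h1 : lam < 1) (s0 : G.S)
    (x : G.StatProf) (i : G.I) (σi : G.BStrat i) :
    IsFlow lam s0 x i (occupation lam s0 (Function.update (toB x) i σi) i) := by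
  set σ := Function.update (toB x) i σi with hσ
  refine ⟨fun z => tsum_nonneg fun l => mul_nonneg (mul_nonneg (pow_nonneg h0 _)
    (probHistAux_nonneg ..)) ((σ i _).2.1 _), fun s => ?_⟩
  have hs : HasSum (fun l : List G.Step => lam ^ l.length * probHistAux s0 σ l s)
      (∑ a, occupation lam s0 σ i ⟨s, a⟩) := by
    refine HasSum.congr_fun (hasSum_sum (s := Finset.univ)
      fun a _ => hasSum_occupation h0 h1 s0 σ i ⟨s, a⟩) fun l => ?_
    dsimp only
    rw [← Finset.mul_sum, (σ i (l, s)).2.2, mul_one]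
  refine hs.unique ?_
  have := hasSum_list_of_cons
    (f := fun l : List G.Step => lam ^ l.length * probHistAux s0 σ l s)
    (b := lam * ∑ st : G.Step, occupation lam s0 σ i ⟨st.1, st.2 i⟩ * othersWeight x i st *
      G.q st.1 st.2 s)
    (fun l => mul_nonneg (pow_nonneg h0 _) (probHistAux_nonneg ..)) ?_
  · simpa [probHistAux] using this
  · refine HasSum.congr_fun ((hasSum_sum (s := Finset.univ) fun (st : G.Step) _ =>
      ((hasSum_occupation h0 h1 s0 σ i ⟨st.1, st.2 i⟩).mul_right
        (othersWeight x i st)).mul_right (G.q st.1 st.2 s)).mul_left lam)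
      fun l => ?_
    rw [Finset.mul_sum]
    refine Finset.sum_congr rfl fun st _ => ?_
    simp only [probHistAux, List.length_cons]
    rw [hσ, prod_update_toB]
    ring

theorem modPayoff_eq_flowPayoff {lam : ℝ} (h0 : 0 ≤ lam) (h1 : lam < 1) (s0 : G.S)
    (x : G.StatProf) (i : G.I) (σi : G.BStrat i) (Di : Finset (Finset G.S))
    (c : Finset G.S → ℝ) :
    modPayoff lam s0 (Function.update (toB x) i σi) i Di c =
      flowPayoff lam x i Di c (occupation lam s0 (Function.update (toB x) i σi) i) := by
  simp only [modPayoff, flowPayoff, UD, tSet, tStep_eq_occupation h0 h1]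

/-- A nonnegative vector on state-action pairs is conditioned by some stationary strategy. -/
theorem exists_stat_factor (i : G.I) (m : (Σ s, G.A i s) → ℝ) (hm : ∀ z, 0 ≤ m z) :
    ∃ xi : G.Stat i, ∀ s a, m ⟨s, a⟩ = (∑ b, m ⟨s, b⟩) * (xi s).1 a := by
  have (s : G.S) : ∃ y : Mixed (G.A i s), ∀ a, m ⟨s, a⟩ = (∑ b, m ⟨s, b⟩) * y.1 a := by
    by_cases h : ∑ b, m ⟨s, b⟩ = 0
    · refine ⟨⟨Pi.single (Classical.arbitrary _) 1, fun a => ?_, by simp⟩, fun a => ?_⟩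
      · exact (Pi.single_nonneg.2 zero_le_one : (0 : G.A i s → ℝ) ≤ _) a
      · rw [h, zero_mul]
        exact (Finset.sum_eq_zero_iff_of_nonneg fun b _ => hm _).1 h a (Finset.mem_univ a)
    · refine ⟨⟨fun a => m ⟨s, a⟩ / ∑ b, m ⟨s, b⟩, fun a => div_nonneg (hm _)
        (Finset.sum_nonneg fun b _ => hm _), ?_⟩, fun a => ?_⟩
      · rw [← Finset.sum_div, div_self h]
      · exact (mul_div_cancel₀ _ h).symm
  choose xi h using this
  exact ⟨xi, h⟩

theorem sum_stat_mul_othersWeight (x : G.StatProf) (i : G.I) (xi : G.Stat i) (s : G.S) :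
    ∑ a : G.Prof s, (xi s).1 (a i) * othersWeight x i ⟨s, a⟩ = 1 := by
  have h (a : G.Prof s) := prod_update_toB x i (toB1 xi) [] ⟨s, a⟩
  simp only [Function.update_self, toB1] at h
  simp only [← h]
  exact sum_prod_mixed fun j => Function.update (toB x) i (toB1 xi) j ([], s)

theorem sum_mul_stat_mul_othersWeight (x : G.StatProf) (i : G.I) (xi : G.Stat i) (d : G.S → ℝ) :
    ∑ s, ∑ st : G.Step, d st.1 * (xi st.1).1 (st.2 i) * othersWeight x i st *
      G.q st.1 st.2 s = ∑ s, d s := by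
  rw [Finset.sum_comm]
  simp only [← Finset.mul_sum, G.q_sum, mul_one]
  rw [Fintype.sum_sigma]
  simp only [mul_assoc, ← Finset.mul_sum, sum_stat_mul_othersWeight, mul_one]

theorem IsFlow.sum_eq {lam : ℝ} {s0 : G.S} {x : G.StatProf} {i : G.I}
    {m : (Σ s, G.A i s) → ℝ} (h : IsFlow lam s0 x i m) (h1 : lam < 1) :
    ∑ z, m z = (1 - lam)⁻¹ := by
  obtain ⟨xi, hxi⟩ := exists_stat_factor i m h.1
  have key : ∑ s, ∑ a, m ⟨s, a⟩ = 1 + lam * ∑ s, ∑ a, m ⟨s, a⟩ := by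
    conv_lhs => rw [Finset.sum_congr rfl fun s _ => h.2 s]
    rw [Finset.sum_add_distrib, ← Finset.mul_sum, Finset.sum_ite_eq' Finset.univ s0]
    simp only [Finset.mem_univ, if_true]
    rw [← sum_mul_stat_mul_othersWeight x i xi fun s => ∑ a, m ⟨s, a⟩]
    simp only [← hxi]
  rw [Fintype.sum_sigma]
  have : (1 - lam) ≠ 0 := by linarith
  field_simp
  linarith

/-- A flow is determined by the stationary strategy conditioning it. -/
theorem IsFlow.eq_of_factor {lam : ℝ} (h0 : 0 ≤ lam) (h1 : lam < 1) {s0 : G.S}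
    {x : G.StatProf} {i : G.I} {m m' : (Σ s, G.A i s) → ℝ} (h : IsFlow lam s0 x i m)
    (h' : IsFlow lam s0 x i m') (xi : G.Stat i)
    (hm : ∀ s a, m ⟨s, a⟩ = (∑ b, m ⟨s, b⟩) * (xi s).1 a)
    (hm' : ∀ s a, m' ⟨s, a⟩ = (∑ b, m' ⟨s, b⟩) * (xi s).1 a) : m = m' := by
  have ow (st : G.Step) : 0 ≤ othersWeight x i st :=
    Finset.prod_nonneg fun j _ => (x j _).2.1 _
  let d : G.S → ℝ := fun s => ∑ a, m ⟨s, a⟩ - ∑ a, m' ⟨s, a⟩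
  have hd (s) : d s = lam * ∑ st : G.Step, d st.1 * (xi st.1).1 (st.2 i) *
      othersWeight x i st * G.q st.1 st.2 s := by
    have e : d s = (∑ a, m ⟨s, a⟩) - ∑ a, m' ⟨s, a⟩ := rfl
    rw [e, h.2, h'.2, add_sub_add_left_eq_sub, ← mul_sub, ← Finset.sum_sub_distrib]
    congr 1
    refine Finset.sum_congr rfl fun st _ => ?_
    rw [hm, hm']
    simp only [d]
    ring
  have hle : ∑ s, |d s| ≤ lam * ∑ s, |d s| := by
    rw [← sum_mul_stat_mul_othersWeight x i xi fun s => |d s|, Finset.mul_sum,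
      sum_mul_stat_mul_othersWeight x i xi fun s => |d s|]
    refine Finset.sum_le_sum fun s _ => ?_
    rw [hd s, abs_mul, abs_of_nonneg h0]
    refine mul_le_mul_of_nonneg_left ((Finset.abs_sum_le_sum_abs _ _).trans_eq ?_) h0
    refine Finset.sum_congr rfl fun st _ => ?_
    rw [abs_mul, abs_mul, abs_mul, abs_of_nonneg (G.q_nonneg _ _ _), abs_of_nonneg (ow st),
      abs_of_nonneg ((xi st.1).2.1 _)]
  have hz : ∑ s, |d s| = 0 := by
    have : 0 ≤ ∑ s, |d s| := Finset.sum_nonneg fun _ _ => abs_nonneg _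
    nlinarith
  funext ⟨s, a⟩
  have hs : |d s| = 0 :=
    (Finset.sum_eq_zero_iff_of_nonneg fun _ _ => abs_nonneg _).1 hz s (Finset.mem_univ s)
  rw [hm, hm', sub_eq_zero.1 (abs_eq_zero.1 hs)]

theorem isCompact_setOf_isFlow {lam : ℝ} (h1 : lam < 1) (s0 : G.S) (x : G.StatProf) (i : G.I) :
    IsCompact {m | IsFlow lam s0 x i m} := by
  refine (isCompact_Icc (a := (0 : (Σ s, G.A i s) → ℝ))
    (b := fun _ => (1 - lam)⁻¹)).of_isClosed_subset ?_ fun m hm => ⟨hm.1, fun z => ?_⟩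
  · simp only [IsFlow, Set.ofPred_and, Set.ofPred_forall]
    refine (isClosed_iInter fun z => isClosed_le continuous_const (continuous_apply z)).inter
      (isClosed_iInter fun s => isClosed_eq (by fun_prop) (by fun_prop))
  · rw [← hm.sum_eq h1]
    exact Finset.single_le_sum (fun z _ => hm.1 z) (Finset.mem_univ z)

theorem continuous_flowPayoff (lam : ℝ) (x : G.StatProf) (i : G.I) (Di : Finset (Finset G.S))
    (c : Finset G.S → ℝ) : Continuous (flowPayoff lam x i Di c) := by
  unfold flowPayoff
  refine continuous_finsetSum _ fun D _ => Continuous.min ?_ (Continuous.mul ?_ continuous_const)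
  all_goals
    refine continuous_finsetSum _ fun st _ => ?_
    split_ifs <;> fun_prop

/-- Every flow is the occupation measure of a stationary strategy. -/
theorem IsFlow.exists_occupation_eq {lam : ℝ} (h0 : 0 ≤ lam) (h1 : lam < 1) {s0 : G.S}
    {x : G.StatProf} {i : G.I} {m : (Σ s, G.A i s) → ℝ} (h : IsFlow lam s0 x i m) :
    ∃ xi : G.Stat i, occupation lam s0 (Function.update (toB x) i (toB1 xi)) i = m := by
  obtain ⟨xi, hxi⟩ := exists_stat_factor i m h.1
  refine ⟨xi, (isFlow_occupation h0 h1 s0 x i (toB1 xi)).eq_of_factor h0 h1 h xi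
    (fun s a => ?_) hxi⟩
  have hocc (b : G.A i s) : occupation lam s0 (Function.update (toB x) i (toB1 xi)) i ⟨s, b⟩ =
      (∑' l : List G.Step, lam ^ l.length *
        probHistAux s0 (Function.update (toB x) i (toB1 xi)) l s) * (xi s).1 b := by
    simp only [occupation, Function.update_self, toB1]
    exact tsum_mul_right
  simp only [hocc, ← Finset.mul_sum, (xi s).2.2, mul_one]

end StocGame

open StocGame in
/-- against a stationary strategy profile of the other players, player `i`
has a stationary best response in the modified game. -/
theorem stmt_5 (G : StocGame) (lam : ℝ) (hlam0 : 0 ≤ lam) (hlam1 : lam < 1) (s0 : G.S)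
    (i : G.I) (Di : Finset (Finset G.S)) (hDi : IsPartitionF Di)
    (c : Finset G.S → ℝ) (x : G.StatProf) :
    ∃ xi : G.Stat i, ∀ σi : G.BStrat i,
      modPayoff lam s0 (Function.update (toB x) i σi) i Di c ≤
        modPayoff lam s0 (Function.update (toB x) i (toB1 xi)) i Di c := by
  obtain ⟨m, hm, hmax⟩ := (isCompact_setOf_isFlow hlam1 s0 x i).exists_isMaxOn
    ⟨_, isFlow_occupation hlam0 hlam1 s0 x i (toB x i)⟩
    (continuous_flowPayoff lam x i Di c).continuousOn
  obtain ⟨xi, hxi⟩ := IsFlow.exists_occupation_eq hlam0 hlam1 hm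
  refine ⟨xi, fun σi => ?_⟩
  rw [modPayoff_eq_flowPayoff hlam0 hlam1, modPayoff_eq_flowPayoff hlam0 hlam1, hxi]
  exact hmax (isFlow_occupation hlam0 hlam1 s0 x i σi)
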